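/- arXiv:2509.07393 — 2 statements merged into one kernel-verified Lean document; each statement's English description precedes it below -/
import Mathlib

section
/- Let G be a finite group, H ≤ G a subgroup, and define the Res-Ind transition matrix P on the set of irreducible characters of G by P = P↓ P↑ where P↓_{ξη} = ⟨Res_H ξ, η⟩ dim η / dim ξ for ξ ∈ Irr(G), η ∈ Irr(H), and P↑_{ημ} = ⟨Ind_H^G η, μ⟩ dim μ / ([G:H] dim η). Then for every conjugacy class C of G, the vector v_C = (χ^ξ(c)/dim ξ)_{ξ ∈ Irr(G)} (with c ∈ C) is an eigenvector of P with eigenvalue |C ∩ H| / |C|. -/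
open CategoryTheory
open scoped Classical

/-- Inner product of class functions on a finite group/monoid carrier:
⟨f,g⟩ = |X|⁻¹ Σ_x f(x) conj(g(x)). -/
noncomputable def classInner (X : Type) (f g : X → ℂ) : ℂ :=
  (Nat.card X : ℂ)⁻¹ * ∑ᶠ x : X, f x * (starRingEnd ℂ) (g x)

/-- The character of the induced representation Ind_H^G of a class function f on H:
(Ind f)(g) = |H|⁻¹ Σ_{x ∈ G, x⁻¹gx ∈ H} f(x⁻¹gx). -/
noncomputable def indChar {G : Type} [Group G] (H : Subgroup G) (f : H → ℂ) : G → ℂ :=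
  fun g => (Nat.card H : ℂ)⁻¹ *
    ∑ᶠ x : G, if hx : x⁻¹ * g * x ∈ H then f ⟨x⁻¹ * g * x, hx⟩ else 0

/-- P↓_{ξη} = ⟨Res_H ξ, η⟩ dim η / dim ξ. -/
noncomputable def Pdown {G : Type} [Group G] (H : Subgroup G)
    (ξ : FDRep ℂ G) (η : FDRep ℂ H) : ℂ :=
  classInner H (fun h => ξ.character h) η.character *
    (Module.finrank ℂ η) / (Module.finrank ℂ ξ)

/-- P↑_{ημ} = ⟨Ind_H^G η, μ⟩ dim μ / ([G:H] dim η). -/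
noncomputable def Pup {G : Type} [Group G] (H : Subgroup G)
    (η : FDRep ℂ H) (μ : FDRep ℂ G) : ℂ :=
  classInner G (indChar H η.character) μ.character *
    (Module.finrank ℂ μ) / ((H.index : ℂ) * (Module.finrank ℂ η))

/-- The Res-Ind matrix P = P↓P↑ on (a complete family indexing) Irr(G). -/
noncomputable def resIndP {G : Type} [Group G] (H : Subgroup G)
    {ιG ιH : Type} [Fintype ιH] (ρ : ιG → FDRep ℂ G) (σ : ιH → FDRep ℂ H)
    (ξ μ : ιG) : ℂ :=
  ∑ η : ιH, Pdown H (ρ ξ) (σ η) * Pup H (σ η) (ρ μ)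

open scoped ComplexOrder in
theorem aux_char_inv {G : Type} [Group G] [Fintype G] (V : FDRep ℂ G) (g : G) :
    (starRingEnd ℂ) (V.character g) = V.character g⁻¹ := by
  let b := Module.finBasis ℂ V
  let M : G →* Matrix _ _ ℂ :=
    (LinearMap.toMatrixAlgEquiv b).toAlgHom.toRingHom.toMonoidHom.comp V.ρ
  have hM : ∀ g, V.character g = (M g).trace := fun g => by
    rw [FDRep.character, LinearMap.trace_eq_matrix_trace ℂ b]; rfl
  let P := ∑ h : G, (M h).conjTranspose * M h
  have hinv : ∀ h, M h * M h⁻¹ = 1 := fun h => by rw [← map_mul]; simp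
  have hinv' : ∀ h, M h⁻¹ * M h = 1 := fun h => by rw [← map_mul]; simp
  have hP : P.PosDef := by
    refine Matrix.posDef_sum Finset.univ_nonempty fun h _ => ?_
    apply Matrix.PosDef.conjTranspose_mul_self
    apply Matrix.mulVec_injective_of_isUnit
    exact IsUnit.of_mul_eq_one _ (hinv h)
  have hPu : IsUnit P := hP.isUnit
  have h1 : (M g).conjTranspose * P * M g = P := by
    simp only [P, Finset.mul_sum, Finset.sum_mul]
    refine Fintype.sum_equiv (Equiv.mulRight g) _ _ fun h => ?_
    simp [Matrix.conjTranspose_mul, mul_assoc]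
  have h2 : (M g).conjTranspose * P = P * M g⁻¹ := by
    calc _ = ((M g).conjTranspose * P * M g) * M g⁻¹ := by rw [mul_assoc _ (M g), hinv, mul_one]
      _ = _ := by rw [h1]
  obtain ⟨u, hu⟩ := hPu
  rw [hM, hM]
  have h3 : (M g).conjTranspose = P * (M g⁻¹ * (↑u⁻¹ : Matrix _ _ ℂ)) := by
    rw [← mul_assoc, ← h2, mul_assoc, ← hu]; simp
  have h4 := congrArg Matrix.trace h3
  rw [Matrix.trace_conjTranspose, Matrix.trace_mul_comm, mul_assoc, ← hu] at h4
  simpa using h4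

open scoped MonoidAlgebra in
set_option maxHeartbeats 1600000 in
theorem aux_class_zero {G : Type} [Group G] [Fintype G] (F : G → ℂ)
    (hF : ∀ g h, F (h * g * h⁻¹) = F g)
    (h0 : ∀ V : FDRep ℂ G, Simple V → ∑ g, F g * V.character g⁻¹ = 0) : F = 0 := by
  let a : ℂ[G] := ∑ g, MonoidAlgebra.single g⁻¹ (F g)
  have hac : ∀ x : ℂ[G], a * x = x * a := by
    intro x
    induction x using MonoidAlgebra.induction_linear with
    | zero => simp
    | add f g hf hg => rw [mul_add, add_mul, hf, hg]
    | single y r =>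
      simp only [a, Finset.sum_mul, Finset.mul_sum, MonoidAlgebra.single_mul_single]
      refine Fintype.sum_equiv (MulAut.conj y⁻¹).toEquiv _ _ fun g => ?_
      have := hF g y⁻¹
      simp only [inv_inv, mul_assoc] at this
      simp [this, mul_assoc, mul_comm]
  have key : a = 0 := by
    have hj : a ∈ Ring.jacobson ℂ[G] := by
      rw [Ring.jacobson, Module.jacobson, Submodule.mem_sInf]
      intro m hm
      have hs : IsSimpleModule ℂ[G] (ℂ[G] ⧸ m) := isSimpleModule_iff_isCoatom.mpr hm
      have : Module.Finite ℂ ℂ[G] := inferInstance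
      have : Module.Finite ℂ (ℂ[G] ⧸ m) := 
        Module.Finite.of_surjective (m.mkQ.restrictScalars ℂ) m.mkQ_surjective
      let r : Representation ℂ G (ℂ[G] ⧸ m) := Representation.ofModule' (ℂ[G] ⧸ m)
      have hr : ∀ (g : G) (v : ℂ[G] ⧸ m), r g v = MonoidAlgebra.single g (1:ℂ) • v := by
        intro g v; rfl
      have hr' : ∀ (x : ℂ[G]) (v : ℂ[G] ⧸ m), r.asAlgebraHom x v = x • v := by
        intro x v
        induction x using MonoidAlgebra.induction_linear with
        | zero => simp
        | add f g hf hg => rw [map_add, add_smul, LinearMap.add_apply, hf, hg]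
        | single y c =>
          rw [Representation.asAlgebraHom_single, LinearMap.smul_apply, hr, ← smul_assoc]
          simp
      let e : r.asModule ≃ₗ[ℂ[G]] (ℂ[G] ⧸ m) :=
        { r.asModuleEquiv.toAddEquiv with
          map_smul' := fun x v => by
            have := r.asModuleEquiv_map_smul x v
            rw [hr'] at this
            exact this }
      have : r.IsIrreducible := by
        rw [Representation.irreducible_iff_isSimpleModule_asModule]
        exact IsSimpleModule.congr e
      let V : FDRep ℂ G := FDRep.of r
      have hcard : (Nat.card G : ℂ) ≠ 0 := by simp
      have hV : ∀ g, V.character g = LinearMap.trace ℂ _ (r g) := fun g => rfl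
      have hVs : Simple V := by
        rw [FDRep.simple_iff_char_is_norm_one]
        have := invertibleOfNonzero hcard
        have := Representation.char_orthonormal r r
        rw [if_pos ⟨Representation.Equiv.refl r⟩, inv_mul_eq_one₀ hcard] at this
        exact this.symm
      have h := h0 V hVs
      let T : Module.End ℂ[G] (ℂ[G] ⧸ m) :=
        { toFun := fun v => a • v
          map_add' := fun v w => smul_add _ _ _
          map_smul' := fun x v => by simp only [smul_smul, hac, RingHom.id_apply] }
      obtain ⟨z, hz⟩ := (IsSimpleModule.algebraMap_end_bijective_of_isAlgClosed (A := ℂ[G]) (V := ℂ[G] ⧸ m) ℂ).2 T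
      have hz' : ∀ v : ℂ[G] ⧸ m, a • v = z • v := fun v => (congrArg (fun t => t v) hz).symm
      have hra : r.asAlgebraHom a = z • LinearMap.id := by
        ext v; rw [hr', hz']; rfl
      have htr := congrArg (LinearMap.trace ℂ _) hra
      have : LinearMap.trace ℂ _ (r.asAlgebraHom a) = 0 := by
        rw [← h]
        simp [a, map_sum, Representation.asAlgebraHom_single, hV]
      rw [this, map_smul, LinearMap.trace_id] at htr
      have : Nontrivial (ℂ[G] ⧸ m) := IsSimpleModule.nontrivial ℂ[G] _
      have hfr : (Module.finrank ℂ (ℂ[G] ⧸ m) : ℂ) ≠ 0 := by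
        exact Nat.cast_ne_zero.mpr (Module.finrank_pos (R := ℂ) (M := ℂ[G] ⧸ m)).ne'
      have hz0 : z = 0 := by
        rcases mul_eq_zero.mp htr.symm with h | h
        · exact h
        · exact absurd h hfr
      have := hz' (Submodule.Quotient.mk 1)
      rw [hz0, zero_smul, ← Submodule.Quotient.mk_smul, Submodule.Quotient.mk_eq_zero] at this
      simpa using this
    rw [IsSemisimpleRing.jacobson_eq_bot] at hj
    simpa using hj
  funext g
  have h := congrArg (fun x : ℂ[G] => x.coeff g⁻¹) key
  simpa [a, Finsupp.single_apply] using h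

theorem aux_expand {G : Type} [Group G] [Fintype G] {ι : Type} [Fintype ι]
    (ρ : ι → FDRep ℂ G)
    (hρs : ∀ i, Simple (ρ i)) (hρd : ∀ i j, Nonempty (ρ i ≅ ρ j) → i = j)
    (hρc : ∀ V : FDRep ℂ G, Simple V → ∃ i, Nonempty (V ≅ ρ i))
    (f : G → ℂ) (hf : ∀ g h, f (h * g * h⁻¹) = f g) (c : G) :
    ∑ i, classInner G f (ρ i).character * (ρ i).character c = f c := by
  have hcard : (Nat.card G : ℂ) ≠ 0 := by simp
  have := invertibleOfNonzero hcard
  have hin : ∀ i, classInner G f (ρ i).character =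
      (Nat.card G : ℂ)⁻¹ * ∑ g, f g * (ρ i).character g⁻¹ := fun i => by
    simp only [classInner, finsum_eq_sum_of_fintype, aux_char_inv]
  have hz := aux_class_zero
    (fun g => f g - ∑ i, classInner G f (ρ i).character * (ρ i).character g)
    (fun g h => by simp only [hf, FDRep.char_conj]) (fun V hV => by
      obtain ⟨j, ⟨e⟩⟩ := hρc V hV
      rw [FDRep.char_iso e]
      have ho : ∀ i, ∑ g, (ρ i).character g * (ρ j).character g⁻¹ =
          if i = j then (Nat.card G : ℂ) else 0 := fun i => by
        have := hρs i
        have := hρs j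
        have h := FDRep.char_orthonormal (ρ i) (ρ j)
        rw [inv_mul_eq_iff_eq_mul₀ hcard] at h
        rw [h]
        by_cases hij : i = j
        · subst hij
          rw [if_pos ⟨Iso.refl _⟩, if_pos rfl, mul_one]
        · rw [if_neg (fun hn => hij (hρd _ _ hn)), if_neg hij, mul_zero]
      simp only [sub_mul, Finset.sum_sub_distrib, Finset.sum_mul]
      rw [Finset.sum_comm]
      simp only [mul_assoc, ← Finset.mul_sum, ho]
      simp only [mul_ite, mul_zero, Finset.sum_ite_eq', Finset.mem_univ, if_true]
      rw [hin]
      field_simp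
      simp)
  have h := congrFun hz c
  simp only [Pi.zero_apply] at h
  exact (sub_eq_zero.mp h).symm

theorem aux_count {G : Type} [Group G] [Fintype G] (H : Subgroup G) (c : G) :
    (Finset.univ.filter fun x : G => x⁻¹ * c * x ∈ H).card * Nat.card {x : G // IsConj c x} =
      Nat.card {x : G // IsConj c x ∧ x ∈ H} * Nat.card G := by
  let k := (Finset.univ.filter fun x : G => x⁻¹ * c * x = c).card
  have hfib : ∀ y, IsConj c y → (Finset.univ.filter fun x : G => x⁻¹ * c * x = y).card = k := by
    intro y hy
    obtain ⟨u, hu⟩ := isConj_iff.mp hy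
    refine Finset.card_equiv (Equiv.mulRight u) fun x => ?_
    simp only [Finset.mem_filter, Finset.mem_univ, true_and, Equiv.coe_mulRight, mul_inv_rev]
    rw [← hu]
    constructor
    · intro h
      calc _ = u⁻¹ * (x⁻¹ * c * x) * u := by group
        _ = c := by rw [h]; group
    · intro h
      calc _ = u * (u⁻¹ * x⁻¹ * c * (x * u)) * u⁻¹ := by group
        _ = _ := by rw [h]
  have hconj : ∀ x : G, IsConj c (x⁻¹ * c * x) := fun x =>
    isConj_iff.mpr ⟨x⁻¹, by simp⟩
  have h1 : (Finset.univ.filter fun x : G => x⁻¹ * c * x ∈ H).card =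
      Nat.card {x : G // IsConj c x ∧ x ∈ H} * k := by
    rw [Nat.card_eq_fintype_card, Fintype.card_subtype,
      Finset.card_eq_sum_card_fiberwise (f := fun x : G => x⁻¹ * c * x)
        (t := Finset.univ.filter fun x : G => IsConj c x ∧ x ∈ H)
        (fun x hx => by
          simp only [Finset.coe_filter, Finset.mem_univ, true_and, Set.mem_ofPred_eq] at hx ⊢
          exact ⟨hconj x, hx⟩)]
    rw [Finset.sum_congr rfl, Finset.sum_const, smul_eq_mul]
    intro y hy
    simp only [Finset.mem_filter, Finset.mem_univ, true_and] at hy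
    rw [← hfib y hy.1, Finset.filter_filter]
    congr 1
    ext x
    simp only [Finset.mem_filter, Finset.mem_univ, true_and]
    exact ⟨fun h => h.2, fun h => ⟨h ▸ hy.2, h⟩⟩
  have h2 : Nat.card G = Nat.card {x : G // IsConj c x} * k := by
    rw [Nat.card_eq_fintype_card, Nat.card_eq_fintype_card, Fintype.card_subtype,
      ← Finset.card_univ, Finset.card_eq_sum_card_fiberwise (f := fun x : G => x⁻¹ * c * x)
        (t := Finset.univ.filter fun x : G => IsConj c x)
        (fun x hx => by
          simp only [Finset.coe_filter, Finset.mem_univ, true_and, Set.mem_ofPred_eq]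
          exact hconj x)]
    rw [Finset.sum_congr rfl, Finset.sum_const, smul_eq_mul]
    intro y hy
    simp only [Finset.mem_filter, Finset.mem_univ, true_and] at hy
    rw [← hfib y hy]
  rw [h1, h2]
  ring

theorem aux_ind_conj {G : Type} [Group G] [Fintype G] (H : Subgroup G) (f : H → ℂ) (g h : G) :
    indChar H f (h * g * h⁻¹) = indChar H f g := by
  simp only [indChar, finsum_eq_sum_of_fintype]
  congr 1
  refine Fintype.sum_equiv (Equiv.mulLeft h⁻¹) _ _ fun x => ?_
  have : x⁻¹ * (h * g * h⁻¹) * x = (h⁻¹ * x)⁻¹ * g * (h⁻¹ * x) := by group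
  have gen : ∀ y z : G, y = z →
      (if hx : y ∈ H then f ⟨y, hx⟩ else 0) = (if hx : z ∈ H then f ⟨z, hx⟩ else 0) := by
    rintro y _ rfl
    rfl
  exact gen _ _ this

theorem aux_finrank {G : Type} [Group G] (V : FDRep ℂ G) [Simple V] :
    (Module.finrank ℂ V : ℂ) ≠ 0 := by
  intro h
  have h' : Module.finrank ℂ V = 0 := by exact_mod_cast h
  have hs : Subsingleton V := Module.finrank_zero_iff.mp h'
  apply id_nonzero V
  ext x
  exact Subsingleton.elim _ _

/-- for every conjugacy class C of G, the vector
v_C = (χ^ξ(c)/dim ξ)_{ξ ∈ Irr(G)} is an eigenvector of the Res-Ind matrix P = P↓P↑ with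
eigenvalue |C ∩ H|/|C|. -/
theorem resIndP_eigenvector_of_conjugacy_class
    (G : Type) [Group G] [Fintype G] (H : Subgroup G)
    (ιG ιH : Type) [Fintype ιG] [Fintype ιH]
    (ρ : ιG → FDRep ℂ G) (σ : ιH → FDRep ℂ H)
    (hρs : ∀ i, Simple (ρ i)) (hρd : ∀ i j, Nonempty (ρ i ≅ ρ j) → i = j)
    (hρc : ∀ V : FDRep ℂ G, Simple V → ∃ i, Nonempty (V ≅ ρ i))
    (hσs : ∀ i, Simple (σ i)) (hσd : ∀ i j, Nonempty (σ i ≅ σ j) → i = j)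
    (hσc : ∀ V : FDRep ℂ H, Simple V → ∃ i, Nonempty (V ≅ σ i))
    (c : G) :
    ∀ ξ, ∑ μ, resIndP H ρ σ ξ μ * ((ρ μ).character c / (Module.finrank ℂ (ρ μ) : ℂ))
      = ((Nat.card {x : G // IsConj c x ∧ (x : G) ∈ H} : ℂ) /
          (Nat.card {x : G // IsConj c x} : ℂ)) *
        ((ρ ξ).character c / (Module.finrank ℂ (ρ ξ) : ℂ)) := by
  intro ξ
  have := hρs
  have := hσs
  have hdG : ∀ i, (Module.finrank ℂ (ρ i) : ℂ) ≠ 0 := fun i => aux_finrank (ρ i)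
  have hdH : ∀ i, (Module.finrank ℂ (σ i) : ℂ) ≠ 0 := fun i => aux_finrank (σ i)
  have hidx : (H.index : ℂ) ≠ 0 := Nat.cast_ne_zero.mpr Subgroup.index_ne_zero_of_finite
  have hHc : (Nat.card H : ℂ) ≠ 0 := by simp
  have hGc : (Nat.card G : ℂ) = Nat.card H * H.index := by
    rw [← H.card_mul_index, Nat.cast_mul]
  have step1 : ∑ μ, resIndP H ρ σ ξ μ * ((ρ μ).character c / (Module.finrank ℂ (ρ μ) : ℂ)) =
      (Module.finrank ℂ (ρ ξ) : ℂ)⁻¹ * (H.index : ℂ)⁻¹ *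
      ∑ η, classInner H (fun h => (ρ ξ).character h) (σ η).character *
        indChar H (σ η).character c := by
    simp only [resIndP, Finset.sum_mul]
    rw [Finset.sum_comm, Finset.mul_sum]
    refine Finset.sum_congr rfl fun η _ => ?_
    rw [← aux_expand ρ hρs hρd hρc _ (aux_ind_conj H (σ η).character) c,
      Finset.mul_sum, Finset.mul_sum]
    refine Finset.sum_congr rfl fun μ _ => ?_
    have := hdG ξ
    have := hdG μ
    have := hdH η
    simp only [Pdown, Pup]
    field_simp
  have step2 : ∑ η, classInner H (fun h => (ρ ξ).character h) (σ η).character *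
        indChar H (σ η).character c = indChar H (fun h => (ρ ξ).character h) c := by
    simp only [indChar, finsum_eq_sum_of_fintype]
    simp only [mul_left_comm _ (Nat.card H : ℂ)⁻¹]
    rw [← Finset.mul_sum]
    congr 1
    simp only [Finset.mul_sum]
    rw [Finset.sum_comm]
    refine Finset.sum_congr rfl fun x _ => ?_
    split_ifs with hx
    · exact aux_expand σ hσs hσd hσc (fun h : H => (ρ ξ).character h)
        (fun g h => by simp) ⟨x⁻¹ * c * x, hx⟩
    · simp
  have step3 : indChar H (fun h => (ρ ξ).character h) c =
      (Nat.card H : ℂ)⁻¹ * ((Finset.univ.filter fun x : G => x⁻¹ * c * x ∈ H).card *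
        (ρ ξ).character c) := by
    simp only [indChar, finsum_eq_sum_of_fintype]
    congr 1
    have : ∀ x : G, (ρ ξ).character (x⁻¹ * c * x) = (ρ ξ).character c := fun x => by
      simpa using (ρ ξ).char_conj c x⁻¹
    simp only [this, dite_eq_ite]
    rw [← Finset.sum_filter, Finset.sum_const, nsmul_eq_mul]
  rw [step1, step2, step3]
  have hC : (Nat.card {x : G // IsConj c x} : ℂ) ≠ 0 := by
    have : Nonempty {x : G // IsConj c x} := ⟨⟨c, IsConj.refl c⟩⟩
    exact Nat.cast_ne_zero.mpr Nat.card_pos.ne'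
  have hcount := congrArg (Nat.cast : ℕ → ℂ) (aux_count H c)
  rw [Nat.cast_mul, Nat.cast_mul, hGc] at hcount
  have := hdG ξ
  generalize (Nat.card {x : G // IsConj c x} : ℂ) = C at *
  generalize (Nat.card {x : G // IsConj c x ∧ x ∈ H} : ℂ) = D at *
  generalize ((Finset.univ.filter fun x : G => x⁻¹ * c * x ∈ H).card : ℂ) = K at *
  field_simp
  linear_combination (ρ ξ).character c * hcount
end

section
/- With dim λ as in the wreath product dimension formula, the reciprocal branching identity holds: n·|T|·dim ν = Σ_{μ : ν ↗ μ} dim ζ_{νμ} · dim μ, where ν is a multi-partition of total size n−1, the sum is over multi-partitions μ of total size n obtained by adding one box to ν, and ζ_{νμ} is the entry where the box is added. -/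
open CategoryTheory

/-- The number of standard Young tableaux of shape μ: bijective fillings of the cells of μ
by 0, …, |μ|−1 that strictly increase along rows and columns. -/
noncomputable def dimSYT (μ : YoungDiagram) : ℕ :=
  Nat.card {f : μ.cells → Fin μ.card //
    Function.Bijective f ∧
      ∀ a b : μ.cells, (a : ℕ × ℕ).1 ≤ (b : ℕ × ℕ).1 → (a : ℕ × ℕ).2 ≤ (b : ℕ × ℕ).2 →
        a ≠ b → f a < f b}

/-- ν ↗ λ : λ is obtained from ν by adding one box. -/
def YDCovers (ν lam : YoungDiagram) : Prop :=
  ν.cells ⊆ lam.cells ∧ lam.card = ν.card + 1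

/-- Dimension of the irreducible representation of the wreath product S_n(T) indexed by a
multi-partition λ = (λ^ζ), where d ζ is the dimension of the irreducible ζ of T:
dim λ = (n!/Π_ζ |λ^ζ|!) · Π_ζ (d ζ)^{|λ^ζ|} dim λ^ζ. -/
noncomputable def wreathDim {ι : Type} [Fintype ι] (d : ι → ℕ) (n : ℕ)
    (lam : ι → YoungDiagram) : ℝ :=
  ((n.factorial : ℝ) / ∏ i, ((lam i).card.factorial : ℝ)) *
    ∏ i, ((d i : ℝ) ^ ((lam i).card) * (dimSYT (lam i) : ℝ))


open scoped MonoidAlgebra in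
noncomputable def ofModuleEquivAsModule {T : Type} [Group T] (S : Type) [AddCommGroup S] [Module ℂ S]
    [Module ℂ[T] S] [IsScalarTower ℂ ℂ[T] S] :
    S ≃ₗ[ℂ[T]] (Representation.ofModule' (k := ℂ) (G := T) S).asModule where
  toAddEquiv := (Representation.asModuleEquiv (Representation.ofModule' (k := ℂ) (G := T) S)).symm.toAddEquiv
  map_smul' r x := by
    apply (Representation.asModuleEquiv (Representation.ofModule' (k := ℂ) (G := T) S)).injective
    simp only [RingHom.id_apply, Representation.asModuleEquiv_map_smul]
    simp [Representation.ofModule', Representation.asAlgebraHom]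
    rfl

theorem finrank_fdrep_hom {T : Type} [Group T] (V W : FDRep ℂ T) :
    Module.finrank ℂ (V ⟶ W) =
      Module.finrank ℂ (Representation.asModule V.ρ →ₗ[MonoidAlgebra ℂ T] Representation.asModule W.ρ) := by
  rw [← (FDRep.forget₂HomLinearEquiv V W).finrank_eq, (Rep.homLinearEquiv _ _).finrank_eq]
  exact (Representation.IntertwiningMap.equivLinearMapAsModule V.ρ W.ρ).finrank_eq

open scoped MonoidAlgebra in
theorem fdrep_simple_of_isSimpleModule {T : Type} [Group T] [Finite T] (S : Type) [AddCommGroup S] [Module ℂ S]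
    [Module ℂ[T] S] [IsScalarTower ℂ ℂ[T] S] [Module.Finite ℂ S] [IsSimpleModule ℂ[T] S] :
    Simple (FDRep.of (Representation.ofModule' (k := ℂ) (G := T) S)) := by
  rw [FDRep.simple_iff_end_is_rank_one, finrank_fdrep_hom, FDRep.of_ρ']
  have e := ofModuleEquivAsModule (T := T) S
  have : IsSimpleModule ℂ[T] (Representation.ofModule' (k := ℂ) (G := T) S).asModule :=
    IsSimpleModule.congr e.symm
  have h2 : Module.Finite ℂ (Representation.ofModule' (k := ℂ) (G := T) S).asModule :=
    Module.Finite.equiv (Representation.asModuleEquiv (Representation.ofModule' (k := ℂ) (G := T) S)).symm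
  have := IsSimpleModule.algebraMap_end_bijective_of_isAlgClosed (A := ℂ[T])
    (V := (Representation.ofModule' (k := ℂ) (G := T) S).asModule) ℂ
  rw [← (LinearEquiv.ofBijective (Algebra.linearMap ℂ _) this).finrank_eq]
  exact Module.finrank_self ℂ

open scoped MonoidAlgebra in
theorem sum_sq_dims (T : Type) [Group T] [Finite T]
    (ι : Type) [Fintype ι] (ρ : ι → FDRep ℂ T)
    (hs : ∀ i, Simple (ρ i)) (hd : ∀ i j, Nonempty (ρ i ≅ ρ j) → i = j)
    (hc : ∀ V : FDRep ℂ T, Simple V → ∃ i, Nonempty (V ≅ ρ i)) :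
    ∑ i, Module.finrank ℂ (ρ i) ^ 2 = Nat.card T := by
  classical
  obtain ⟨n, S, e, hS⟩ := IsSemisimpleModule.exists_linearEquiv_fin_dfinsupp ℂ[T] ℂ[T]
  have hfin : Module.Finite ℂ ℂ[T] := Module.Finite.of_basis (MonoidAlgebra.basis T ℂ)
  have hfS : ∀ j, Module.Finite ℂ (S j) := fun j =>
    Module.Finite.of_injective ((S j).subtype.restrictScalars ℂ) Subtype.val_injective
  have hV := fun j => fdrep_simple_of_isSimpleModule (T := T) (S j)
  choose c hcc using fun j => hc _ (hV j)
  have hdim : ∀ j, Module.finrank ℂ (S j) = Module.finrank ℂ (ρ (c j)) := fun j =>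
    (FDRep.isoToLinearEquiv (hcc j).some).finrank_eq
  have hhom : ∀ i j, Module.finrank ℂ (S j →ₗ[ℂ[T]] Representation.asModule (ρ i).ρ) = if c j = i then 1 else 0 := by
    intro i j
    have h1 := finrank_fdrep_hom (FDRep.of (Representation.ofModule' (k := ℂ) (G := T) (S j))) (ρ i)
    have := hV j
    have := hs i
    rw [FDRep.finrank_hom_simple_simple, FDRep.of_ρ'] at h1
    have e1 : (S j →ₗ[ℂ[T]] Representation.asModule (ρ i).ρ) ≃ₗ[ℂ]
      ((Representation.ofModule' (k := ℂ) (G := T) (S j)).asModule →ₗ[ℂ[T]] Representation.asModule (ρ i).ρ) :=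
      LinearEquiv.congrLeft _ ℂ (ofModuleEquivAsModule (T := T) (S j))
    rw [e1.finrank_eq, ← h1]
    congr 1
    apply propext
    constructor
    · rintro ⟨f⟩
      exact hd _ _ ⟨(hcc j).some.symm ≪≫ f⟩
    · rintro rfl
      exact hcc j
  have hmult : ∀ i, Module.finrank ℂ (ρ i) = ∑ j, if c j = i then 1 else 0 := by
    intro i
    have e1 : (ℂ[T] →ₗ[ℂ[T]] Representation.asModule (ρ i).ρ) ≃ₗ[ℂ] ((Π₀ j, S j) →ₗ[ℂ[T]] Representation.asModule (ρ i).ρ) :=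
      LinearEquiv.congrLeft _ ℂ e
    have e2 := DFinsupp.lsum (R := ℂ[T]) ℂ (M := fun j => S j) (N := Representation.asModule (ρ i).ρ)
    have e3 := LinearMap.ringLmapEquivSelf ℂ[T] ℂ (Representation.asModule (ρ i).ρ)
    have hfi : Module.Finite ℂ (Representation.asModule (ρ i).ρ) := Module.Finite.equiv (Representation.asModuleEquiv (ρ i).ρ).symm
    have : ∀ j, Module.Finite ℂ (S j →ₗ[ℂ[T]] Representation.asModule (ρ i).ρ) := fun j =>
      Module.Finite.of_injective (LinearMap.restrictScalarsₗ ℂ ℂ[T] (S j) (Representation.asModule (ρ i).ρ) ℂ)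
        (LinearMap.restrictScalars_injective _)
    rw [← (Representation.asModuleEquiv (ρ i).ρ).finrank_eq, ← e3.finrank_eq, e1.finrank_eq, ← e2.finrank_eq,
      Module.finrank_pi_fintype]
    exact Finset.sum_congr rfl fun j _ => hhom i j
  have htot : Nat.card T = ∑ j, Module.finrank ℂ (ρ (c j)) := by
    have h1 : Module.finrank ℂ ℂ[T] = Nat.card T :=
      Module.finrank_eq_nat_card_basis (MonoidAlgebra.basis T ℂ)
    have e1 := (e.trans DFinsupp.linearEquivFunOnFintype).restrictScalars ℂ
    rw [← h1, e1.finrank_eq, Module.finrank_pi_fintype]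
    exact Finset.sum_congr rfl fun j _ => hdim j
  rw [htot]
  calc ∑ i, Module.finrank ℂ (ρ i) ^ 2
      = ∑ i, ∑ j, if c j = i then Module.finrank ℂ (ρ i) else 0 := by
        refine Finset.sum_congr rfl fun i _ => ?_
        rw [sq]
        conv_lhs => rw [hmult i]
        rw [Finset.sum_mul]
        conv_lhs => rw [← hmult i]
        simp
    _ = _ := by
        rw [Finset.sum_comm]
        simp

namespace YoungAux

/-- Standard tableaux as functions on the whole quadrant. -/
def IsSYT (μ : YoungDiagram) (f : ℕ × ℕ → ℕ) : Prop :=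
  (∀ x, x ∉ μ → f x = 0) ∧ Set.BijOn f (μ.cells : Set (ℕ × ℕ)) (Set.Iio μ.card) ∧
    ∀ a ∈ μ, ∀ b ∈ μ, a.1 ≤ b.1 → a.2 ≤ b.2 → a ≠ b → f a < f b

theorem dimSYT_eq (μ : YoungDiagram) : dimSYT μ = Nat.card {f // IsSYT μ f} := by
  classical
  unfold dimSYT
  symm
  refine Nat.card_eq_of_bijective (fun f : {f // IsSYT μ f} =>
    ⟨fun a : μ.cells => (⟨f.1 a.1, f.2.2.1.mapsTo a.2⟩ : Fin μ.card), ⟨?_, ?_⟩, ?_⟩) ⟨?_, ?_⟩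
  · intro a b h
    exact Subtype.ext (f.2.2.1.injOn a.2 b.2 (congrArg Fin.val h))
  · intro y
    obtain ⟨x, hx, h⟩ := f.2.2.1.surjOn (show (y : ℕ) ∈ Set.Iio μ.card from y.2)
    exact ⟨⟨x, hx⟩, Fin.ext h⟩
  · intro a b h1 h2 h3
    exact f.2.2.2 a.1 ((YoungDiagram.mem_cells _).1 a.2) b.1 ((YoungDiagram.mem_cells _).1 b.2) h1 h2 (fun h => h3 (Subtype.ext h))
  · intro f g h
    apply Subtype.ext
    funext x
    by_cases hx : x ∈ μ
    · exact congrArg Fin.val (congrFun (congrArg Subtype.val h) ⟨x, (YoungDiagram.mem_cells _).2 hx⟩)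
    · rw [f.2.1 x hx, g.2.1 x hx]
  · rintro ⟨g, hg, hm⟩
    refine ⟨⟨fun x => if hx : x ∈ μ.cells then (g ⟨x, hx⟩ : ℕ) else 0, ?_, ⟨?_, ?_, ?_⟩, ?_⟩, ?_⟩
    · intro x hx
      exact dif_neg (fun h => hx ((YoungDiagram.mem_cells _).1 h))
    · intro x hx
      have hx' : x ∈ μ.cells := hx
      simp only [dif_pos hx']
      exact (g ⟨x, hx'⟩).2
    · intro x hx y hy h
      have hx' : x ∈ μ.cells := hx
      have hy' : y ∈ μ.cells := hy
      simp only [dif_pos hx', dif_pos hy'] at h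
      have := hg.1 (Fin.ext h)
      exact congrArg Subtype.val this
    · intro y hy
      obtain ⟨x, hx⟩ := hg.2 ⟨y, hy⟩
      refine ⟨x.1, x.2, ?_⟩
      have := x.2
      simp only [dif_pos this]
      exact congrArg Fin.val hx
    · intro a ha b hb h1 h2 h3
      have ha' := (YoungDiagram.mem_cells _).2 ha
      have hb' := (YoungDiagram.mem_cells _).2 hb
      simp only [dif_pos ha', dif_pos hb']
      exact hm ⟨a, ha'⟩ ⟨b, hb'⟩ h1 h2 (fun h => h3 (congrArg Subtype.val h))
    · apply Subtype.ext
      funext x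
      apply Fin.ext
      have := x.2
      simp only [dif_pos this]

theorem finite_isSYT (μ : YoungDiagram) : Finite {f // IsSYT μ f} := by
  refine Finite.of_injective (fun f : {f // IsSYT μ f} =>
    fun a : μ.cells => (⟨f.1 a.1, f.2.2.1.mapsTo a.2⟩ : Fin μ.card)) ?_
  intro f g h
  apply Subtype.ext
  funext x
  by_cases hx : x ∈ μ
  · exact congrArg Fin.val (congrFun h ⟨x, (YoungDiagram.mem_cells _).2 hx⟩)
  · rw [f.2.1 x hx, g.2.1 x hx]

theorem ext_cells {μ ν : YoungDiagram} (h : μ.cells = ν.cells) : μ = ν := YoungDiagram.ext h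

theorem covers_iff {ν μ : YoungDiagram} :
    YDCovers ν μ ↔ ∃ c, c ∉ ν ∧ μ.cells = insert c ν.cells := by
  constructor
  · rintro ⟨h1, h2⟩
    have hc : (μ.cells \ ν.cells).card = 1 := by
      rw [Finset.card_sdiff_of_subset h1]
      change μ.card - ν.card = 1
      omega
    obtain ⟨c, hc⟩ := Finset.card_eq_one.1 hc
    have : c ∈ μ.cells \ ν.cells := by simp [hc]
    refine ⟨c, by simpa using (Finset.mem_sdiff.1 this).2, ?_⟩
    rw [Finset.insert_eq, ← hc, Finset.sdiff_union_of_subset h1]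
  · rintro ⟨c, hc, h⟩
    refine ⟨by rw [h]; exact Finset.subset_insert _ _, ?_⟩
    unfold YoungDiagram.card
    rw [h, Finset.card_insert_of_notMem (by simpa using hc)]

theorem finite_down (μ : YoungDiagram) : {κ | YDCovers κ μ}.Finite := by
  refine Set.Finite.of_finite_image (f := YoungDiagram.cells)
    ((μ.cells.powerset.finite_toSet).subset ?_) ?_
  · rintro _ ⟨κ, h, rfl⟩
    simpa using h.1
  · intro a _ b _ h
    exact ext_cells h

noncomputable def D (μ : YoungDiagram) : Finset YoungDiagram := (finite_down μ).toFinset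

theorem mem_D {κ μ : YoungDiagram} : κ ∈ D μ ↔ YDCovers κ μ := by simp [D]

/-- glue -/
def glue (κ μ : YoungDiagram) (g : ℕ × ℕ → ℕ) : ℕ × ℕ → ℕ :=
  fun x => if x ∈ κ then g x else if x ∈ μ then κ.card else 0

theorem glue_isSYT {κ μ : YoungDiagram} (h : YDCovers κ μ) {g : ℕ × ℕ → ℕ} (hg : IsSYT κ g) :
    IsSYT μ (glue κ μ g) := by
  obtain ⟨c, hc, hcells⟩ := covers_iff.1 h
  have hmem : ∀ x, x ∈ μ ↔ x = c ∨ x ∈ κ := by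
    intro x
    rw [← YoungDiagram.mem_cells, hcells]; simp
  have hgc : glue κ μ g c = κ.card := by simp [glue, hc, hmem]
  have hgk : ∀ x ∈ κ, glue κ μ g x = g x := by intro x hx; simp [glue, hx]
  have hlt : ∀ x ∈ κ, g x < κ.card := fun x hx => hg.2.1.mapsTo (by simpa using hx)
  have hcard := h.2
  refine ⟨?_, ⟨?_, ?_, ?_⟩, ?_⟩
  · intro x hx
    have hx2 : x ∉ κ := fun h => hx ((hmem x).2 (Or.inr h))
    simp [glue, hx, hx2]
  · intro x hx
    rcases (hmem x).1 (by simpa using hx) with rfl | hx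
    · rw [hgc]; simp [hcard]
    · rw [hgk x hx]; have := hlt x hx; simp only [Set.mem_Iio]; omega
  · intro x hx y hy hxy
    rcases (hmem x).1 (by simpa using hx) with rfl | hx <;>
      rcases (hmem y).1 (by simpa using hy) with rfl | hy
    · rfl
    · rw [hgc, hgk y hy] at hxy; have := hlt y hy; omega
    · rw [hgc, hgk x hx] at hxy; have := hlt x hx; omega
    · rw [hgk y hy, hgk x hx] at hxy
      exact hg.2.1.injOn (by simpa using hx) (by simpa using hy) hxy
  · intro y hy
    simp only [Set.mem_Iio, hcard] at hy
    rcases Nat.lt_succ_iff_lt_or_eq.1 hy with hy | rfl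
    · obtain ⟨x, hx, h⟩ := hg.2.1.surjOn (show y ∈ Set.Iio κ.card from hy)
      have hx : x ∈ κ := by simpa using hx
      exact ⟨x, by simpa using (hmem x).2 (Or.inr hx), by rw [hgk x hx, h]⟩
    · exact ⟨c, by simpa using (hmem c).2 (Or.inl rfl), hgc⟩
  · intro a ha b hb h1 h2 h3
    rcases (hmem a).1 ha with rfl | ha' <;> rcases (hmem b).1 hb with rfl | hb'
    · exact absurd rfl h3
    · exact absurd (κ.up_left_mem h1 h2 hb') hc
    · rw [hgc, hgk a ha']; exact hlt a ha'
    · rw [hgk a ha', hgk b hb']; exact hg.2.2 a ha' b hb' h1 h2 h3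

theorem glue_mem_iff {κ μ : YoungDiagram} (h : YDCovers κ μ) {g : ℕ × ℕ → ℕ} (hg : IsSYT κ g)
    (x : ℕ × ℕ) : x ∈ κ ↔ x ∈ μ ∧ glue κ μ g x + 1 < μ.card := by
  have hlt : ∀ x ∈ κ, g x < κ.card := fun x hx => hg.2.1.mapsTo (by simpa using hx)
  have hcard := h.2
  constructor
  · intro hx
    have h2 := hlt x hx
    refine ⟨(YoungDiagram.mem_cells _).1 (h.1 ((YoungDiagram.mem_cells _).2 hx)), ?_⟩
    simp only [glue, if_pos hx]
    omega
  · rintro ⟨hx, h2⟩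
    by_contra h3
    simp only [glue, if_pos hx, if_neg h3] at h2
    omega

theorem dimSYT_rec (μ : YoungDiagram) (hμ : 0 < μ.card) :
    dimSYT μ = ∑ κ ∈ D μ, dimSYT κ := by
  classical
  have hfin := finite_isSYT
  rw [← Finset.sum_coe_sort]
  simp_rw [dimSYT_eq]
  rw [← Nat.card_sigma]
  symm
  refine Nat.card_eq_of_bijective (fun p : (Σ κ : D μ, {f // IsSYT κ.1 f}) =>
    (⟨glue p.1.1 μ p.2.1, glue_isSYT (mem_D.1 p.1.2) p.2.2⟩ : {f // IsSYT μ f})) ⟨?_, ?_⟩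
  · rintro ⟨⟨κ, hκ⟩, ⟨g, hg⟩⟩ ⟨⟨κ', hκ'⟩, ⟨g', hg'⟩⟩ h
    have h' : glue κ μ g = glue κ' μ g' := congrArg Subtype.val h
    have : κ = κ' := by
      apply SetLike.ext
      intro x
      rw [glue_mem_iff (mem_D.1 hκ) hg, glue_mem_iff (mem_D.1 hκ') hg', h']
    subst this
    have : g = g' := by
      funext x
      by_cases hx : x ∈ κ
      · have := congrFun h' x
        simpa [glue, hx] using this
      · rw [hg.1 x hx, hg'.1 x hx]
    subst this
    rfl
  · rintro ⟨f, hf⟩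
    let κ : YoungDiagram := ⟨μ.cells.filter (fun x => f x + 1 < μ.card), by
      intro a b hab ha
      simp only [Finset.coe_filter, Set.mem_setOf_eq, YoungDiagram.mem_cells] at ha ⊢
      have hb : b ∈ μ := μ.up_left_mem hab.1 hab.2 ha.1
      refine ⟨hb, ?_⟩
      by_cases h : b = a
      · rw [h]; exact ha.2
      · have := hf.2.2 b hb a ha.1 hab.1 hab.2 h
        omega⟩
    have hκmem : ∀ x, x ∈ κ ↔ x ∈ μ ∧ f x + 1 < μ.card := by
      intro x
      rw [← YoungDiagram.mem_cells]
      simp [κ]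
    obtain ⟨c, hc, hcf⟩ := hf.2.1.surjOn (show μ.card - 1 ∈ Set.Iio μ.card by
      simp only [Set.mem_Iio]; omega)
    have hc : c ∈ μ := by simpa using hc
    have hcκ : c ∉ κ := by rw [hκmem]; omega
    have hins : μ.cells = insert c κ.cells := by
      ext x
      simp only [Finset.mem_insert, YoungDiagram.mem_cells, hκmem]
      constructor
      · intro hx
        by_cases h : f x + 1 < μ.card
        · exact Or.inr ⟨hx, h⟩
        · left
          have h2 : f x < μ.card := hf.2.1.mapsTo (by simpa using hx)
          exact hf.2.1.injOn (by simpa using hx) (by simpa using hc) (by omega)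
      · rintro (rfl | h)
        · exact hc
        · exact h.1
    have hcov : YDCovers κ μ := covers_iff.2 ⟨c, hcκ, hins⟩
    have hkc := hcov.2
    have hg : IsSYT κ (fun x => if x ∈ κ then f x else 0) := by
      refine ⟨fun x hx => if_neg hx, ⟨?_, ?_, ?_⟩, ?_⟩
      · intro x hx
        have hx : x ∈ κ := by simpa using hx
        simp only [if_pos hx, Set.mem_Iio]
        have := ((hκmem x).1 hx).2
        omega
      · intro x hx y hy h
        have hx : x ∈ κ := by simpa using hx
        have hy : y ∈ κ := by simpa using hy
        simp only [if_pos hx, if_pos hy] at h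
        exact hf.2.1.injOn (by simpa using ((hκmem x).1 hx).1) (by simpa using ((hκmem y).1 hy).1) h
      · intro y hy
        simp only [Set.mem_Iio] at hy
        obtain ⟨x, hx, h⟩ := hf.2.1.surjOn (show y ∈ Set.Iio μ.card by
          simp only [Set.mem_Iio]; omega)
        have hx : x ∈ κ := (hκmem x).2 ⟨by simpa using hx, by omega⟩
        exact ⟨x, by simpa using hx, by simp only [if_pos hx]; exact h⟩
      · intro a ha b hb h1 h2 h3
        simp only [if_pos ha, if_pos hb]
        exact hf.2.2 a ((hκmem a).1 ha).1 b ((hκmem b).1 hb).1 h1 h2 h3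
    refine ⟨⟨⟨κ, mem_D.2 hcov⟩, ⟨_, hg⟩⟩, ?_⟩
    apply Subtype.ext
    funext x
    simp only [glue]
    by_cases hx : x ∈ κ
    · simp [hx]
    · simp only [if_neg hx]
      by_cases hx2 : x ∈ μ
      · rw [if_pos hx2]
        have h2 : f x < μ.card := hf.2.1.mapsTo (by simpa using hx2)
        have h3 : ¬ (f x + 1 < μ.card) := fun h => hx ((hκmem x).2 ⟨hx2, h⟩)
        omega
      · rw [if_neg hx2, hf.1 x hx2]

/-- Rows in which a box can be added. -/
def AddRow (μ : YoungDiagram) (i : ℕ) : Prop := i = 0 ∨ μ.rowLen i < μ.rowLen (i - 1)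

/-- Rows in which a box can be removed. -/
def RemRow (μ : YoungDiagram) (i : ℕ) : Prop := μ.rowLen (i + 1) < μ.rowLen i

def addBox (μ : YoungDiagram) (i : ℕ) (h : AddRow μ i) : YoungDiagram where
  cells := insert (i, μ.rowLen i) μ.cells
  isLowerSet := by
    rintro ⟨a1, a2⟩ ⟨b1, b2⟩ hab ha
    have h1 : b1 ≤ a1 := hab.1
    have h2 : b2 ≤ a2 := hab.2
    simp only [Finset.coe_insert, Set.mem_insert_iff, Prod.mk.injEq, Finset.mem_coe,
      YoungDiagram.mem_cells, YoungDiagram.mem_iff_lt_rowLen] at ha ⊢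
    rcases ha with ⟨rfl, rfl⟩ | ha
    · rcases Nat.lt_or_ge b1 a1 with hb | hb
      · right
        rcases h with rfl | h
        · omega
        · have := μ.rowLen_anti b1 (a1 - 1) (by omega)
          omega
      · have : b1 = a1 := by omega
        subst this
        omega
    · right
      have := μ.rowLen_anti b1 a1 h1
      omega

theorem addBox_covers (μ : YoungDiagram) (i : ℕ) (h : AddRow μ i) : YDCovers μ (addBox μ i h) :=
  covers_iff.2 ⟨(i, μ.rowLen i), by simp [YoungDiagram.mem_iff_lt_rowLen], rfl⟩

def remBox (μ : YoungDiagram) (i : ℕ) (h : RemRow μ i) : YoungDiagram where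
  cells := μ.cells.erase (i, μ.rowLen i - 1)
  isLowerSet := by
    rintro ⟨a1, a2⟩ ⟨b1, b2⟩ hab ha
    have h1 : b1 ≤ a1 := hab.1
    have h2 : b2 ≤ a2 := hab.2
    simp only [Finset.coe_erase, Set.mem_sdiff, Set.mem_singleton_iff, Prod.mk.injEq, Finset.mem_coe,
      YoungDiagram.mem_cells, YoungDiagram.mem_iff_lt_rowLen] at ha ⊢
    unfold RemRow at h
    have := μ.rowLen_anti b1 a1 h1
    refine ⟨by omega, ?_⟩
    rintro ⟨rfl, rfl⟩
    rcases Nat.lt_or_ge b1 a1 with hb | hb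
    · have := μ.rowLen_anti (b1 + 1) a1 hb
      omega
    · have : b1 = a1 := by omega
      subst this
      omega

theorem remBox_covers (μ : YoungDiagram) (i : ℕ) (h : RemRow μ i) : YDCovers (remBox μ i h) μ := by
  refine covers_iff.2 ⟨(i, μ.rowLen i - 1), ?_, ?_⟩
  · rw [← YoungDiagram.mem_cells]
    simp [remBox]
  · simp only [remBox]
    rw [Finset.insert_erase]
    unfold RemRow at h
    simp only [YoungDiagram.mem_cells, YoungDiagram.mem_iff_lt_rowLen]
    omega

theorem card_up_rows (μ : YoungDiagram) :
    Nat.card {i // AddRow μ i} = Nat.card {σ // YDCovers μ σ} := by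
  refine Nat.card_eq_of_bijective
    (fun i : {i // AddRow μ i} => (⟨addBox μ i.1 i.2, addBox_covers μ i.1 i.2⟩ : {σ // YDCovers μ σ})) ⟨?_, ?_⟩
  · rintro ⟨i, hi⟩ ⟨j, hj⟩ h
    have h' : insert (i, μ.rowLen i) μ.cells = insert (j, μ.rowLen j) μ.cells :=
      congrArg (fun s => s.1.cells) h
    have : (i, μ.rowLen i) ∈ insert (j, μ.rowLen j) μ.cells := by
      rw [← h']; exact Finset.mem_insert_self _ _
    simp only [Finset.mem_insert, Prod.mk.injEq, YoungDiagram.mem_cells,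
      YoungDiagram.mem_iff_lt_rowLen, lt_irrefl, or_false] at this
    exact Subtype.ext this.1
  · rintro ⟨σ, hσ⟩
    obtain ⟨⟨i, j⟩, hc, hins⟩ := covers_iff.1 hσ
    have hmem : ∀ x, x ∈ σ ↔ x = (i, j) ∨ x ∈ μ := by
      intro x
      rw [← YoungDiagram.mem_cells, hins]; simp
    have hij : (i, j) ∈ σ := (hmem _).2 (Or.inl rfl)
    rw [YoungDiagram.mem_iff_lt_rowLen] at hc
    have hj : j = μ.rowLen i := by
      by_contra hne
      have h1 := σ.up_left_mem (le_refl i) (show μ.rowLen i ≤ j by omega) hij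
      rcases (hmem _).1 h1 with h | h
      · simp only [Prod.mk.injEq] at h; omega
      · rw [YoungDiagram.mem_iff_lt_rowLen] at h; omega
    have hi : AddRow μ i := by
      by_contra hne
      unfold AddRow at hne
      push Not at hne
      have h1 := σ.up_left_mem (show i - 1 ≤ i by omega) (le_refl j) hij
      rcases (hmem _).1 h1 with h | h
      · simp only [Prod.mk.injEq] at h; omega
      · rw [YoungDiagram.mem_iff_lt_rowLen] at h; omega
    refine ⟨⟨i, hi⟩, Subtype.ext (ext_cells ?_)⟩
    simp only [addBox]
    rw [hins, hj]

theorem card_down_rows (μ : YoungDiagram) :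
    Nat.card {i // RemRow μ i} = Nat.card {κ // YDCovers κ μ} := by
  refine Nat.card_eq_of_bijective
    (fun i : {i // RemRow μ i} => (⟨remBox μ i.1 i.2, remBox_covers μ i.1 i.2⟩ : {κ // YDCovers κ μ})) ⟨?_, ?_⟩
  · rintro ⟨i, hi⟩ ⟨j, hj⟩ h
    have h' : μ.cells.erase (i, μ.rowLen i - 1) = μ.cells.erase (j, μ.rowLen j - 1) :=
      congrArg (fun s => s.1.cells) h
    have h2 : (i, μ.rowLen i - 1) ∉ μ.cells.erase (j, μ.rowLen j - 1) := by
      rw [← h']; exact Finset.notMem_erase _ _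
    simp only [Finset.mem_erase, Prod.mk.injEq, YoungDiagram.mem_cells, ne_eq,
      YoungDiagram.mem_iff_lt_rowLen] at h2
    unfold RemRow at hi
    apply Subtype.ext
    by_contra hne
    exact h2 ⟨fun h => hne h.1, by omega⟩
  · rintro ⟨κ, hκ⟩
    obtain ⟨⟨i, j⟩, hc, hins⟩ := covers_iff.1 hκ
    have hmem : ∀ x, x ∈ μ ↔ x = (i, j) ∨ x ∈ κ := by
      intro x
      rw [← YoungDiagram.mem_cells, hins]; simp
    have hij : (i, j) ∈ μ := (hmem _).2 (Or.inl rfl)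
    rw [YoungDiagram.mem_iff_lt_rowLen] at hij
    have hj : μ.rowLen i = j + 1 := by
      by_contra hne
      have h1 : (i, j + 1) ∈ μ := YoungDiagram.mem_iff_lt_rowLen.2 (by omega)
      rcases (hmem _).1 h1 with h | h
      · simp at h
      · exact hc (κ.up_left_mem (le_refl i) (Nat.le_succ j) h)
    have hi : RemRow μ i := by
      by_contra hne
      unfold RemRow at hne
      have h1 : (i + 1, j) ∈ μ := YoungDiagram.mem_iff_lt_rowLen.2 (by omega)
      rcases (hmem _).1 h1 with h | h
      · simp at h
      · exact hc (κ.up_left_mem (Nat.le_succ i) (le_refl j) h)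
    refine ⟨⟨i, hi⟩, Subtype.ext (ext_cells ?_)⟩
    simp only [remBox]
    rw [hj, hins, Nat.add_sub_cancel, Finset.erase_insert (by simpa using hc)]

theorem finite_remRow (μ : YoungDiagram) : Finite {i // RemRow μ i} := by
  have : {i | RemRow μ i}.Finite := by
    refine (Set.finite_Iio (μ.colLen 0)).subset ?_
    intro i hi
    have hi : μ.rowLen (i + 1) < μ.rowLen i := hi
    simp only [Set.mem_Iio]
    rw [← YoungDiagram.mem_iff_lt_colLen, YoungDiagram.mem_iff_lt_rowLen]
    omega
  exact this

def optRowEquiv (μ : YoungDiagram) : Option {i // RemRow μ i} → {i // AddRow μ i}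
  | none => ⟨0, Or.inl rfl⟩
  | some i => ⟨i.1 + 1, Or.inr i.2⟩

theorem optRow_bij (μ : YoungDiagram) : Function.Bijective (optRowEquiv μ) := by
  constructor
  · rintro (_ | ⟨i, hi⟩) (_ | ⟨j, hj⟩) h
    · rfl
    · exact absurd (congrArg Subtype.val h) (Nat.succ_ne_zero j).symm
    · exact absurd (congrArg Subtype.val h) (Nat.succ_ne_zero i)
    · have h' : i + 1 = j + 1 := congrArg Subtype.val h
      have h'' : i = j := by omega
      subst h''; rfl
  · rintro ⟨_ | i, hi⟩
    · exact ⟨none, rfl⟩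
    · refine ⟨some ⟨i, ?_⟩, rfl⟩
      rcases hi with h | h
      · omega
      · exact h

theorem card_addRow (μ : YoungDiagram) :
    Nat.card {i // AddRow μ i} = Nat.card {i // RemRow μ i} + 1 := by
  have := finite_remRow μ
  rw [← Nat.card_eq_of_bijective _ (optRow_bij μ), Finite.card_option]

theorem finite_up (μ : YoungDiagram) : {σ | YDCovers μ σ}.Finite := by
  have : Finite {σ // YDCovers μ σ} := by
    apply Nat.finite_of_card_ne_zero
    rw [← card_up_rows, card_addRow]
    omega
  exact this

noncomputable def U (μ : YoungDiagram) : Finset YoungDiagram := (finite_up μ).toFinset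

theorem mem_U {σ μ : YoungDiagram} : σ ∈ U μ ↔ YDCovers μ σ := by simp [U]

theorem card_U (μ : YoungDiagram) : (U μ).card = (D μ).card + 1 := by
  have h1 : (U μ).card = Nat.card {σ // YDCovers μ σ} := by
    exact (Nat.card_eq_card_finite_toFinset (finite_up μ)).symm
  have h2 : (D μ).card = Nat.card {κ // YDCovers κ μ} := by
    exact (Nat.card_eq_card_finite_toFinset (finite_down μ)).symm
  rw [h1, h2, ← card_up_rows, ← card_down_rows, card_addRow]

theorem covers_sup {κ a b : YoungDiagram} (ha : YDCovers κ a) (hb : YDCovers κ b) (h : a ≠ b) :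
    YDCovers a (a ⊔ b) ∧ a ⊓ b = κ := by
  obtain ⟨c, hc, hca⟩ := covers_iff.1 ha
  obtain ⟨d, hd, hdb⟩ := covers_iff.1 hb
  have hcd : c ≠ d := by
    rintro rfl
    exact h (ext_cells (by rw [hca, hdb]))
  constructor
  · refine covers_iff.2 ⟨d, ?_, ?_⟩
    · rw [← YoungDiagram.mem_cells, hca]
      simp [hcd.symm, hd]
    · rw [YoungDiagram.cells_sup, hca, hdb]
      grind
  · apply ext_cells
    rw [YoungDiagram.cells_inf, hca, hdb]
    rw [← YoungDiagram.mem_cells] at hc hd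
    grind

theorem covers_inf {σ a b : YoungDiagram} (ha : YDCovers a σ) (hb : YDCovers b σ) (h : a ≠ b) :
    YDCovers (a ⊓ b) a ∧ a ⊔ b = σ := by
  obtain ⟨c, hc, hca⟩ := covers_iff.1 ha
  obtain ⟨d, hd, hdb⟩ := covers_iff.1 hb
  rw [← YoungDiagram.mem_cells] at hc hd
  have hcd : c ≠ d := by
    rintro rfl
    exact h (ext_cells (by
      rw [← Finset.erase_insert hc, ← Finset.erase_insert hd, ← hca, ← hdb]))
  have hmem : ∀ x, x ∈ insert c a.cells ↔ x ∈ insert d b.cells := by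
    intro x; rw [← hca, ← hdb]
  simp only [Finset.mem_insert] at hmem
  constructor
  · refine covers_iff.2 ⟨d, ?_, ?_⟩
    · rw [← YoungDiagram.mem_cells, YoungDiagram.cells_inf]
      simp only [Finset.mem_inter]
      tauto
    · rw [YoungDiagram.cells_inf]
      ext x
      simp only [Finset.mem_insert, Finset.mem_inter]
      grind
  · apply ext_cells
    rw [YoungDiagram.cells_sup, hca]
    ext x
    simp only [Finset.mem_insert, Finset.mem_union]
    grind

theorem covers_pos {κ μ : YoungDiagram} (h : YDCovers κ μ) : 0 < μ.card := by
  have := h.2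
  omega

theorem sum_UD (τ : YoungDiagram) (F : YoungDiagram → ℕ) :
    ∑ σ ∈ U τ, ∑ t ∈ D σ, F t = F τ + ∑ κ ∈ D τ, ∑ t ∈ U κ, F t := by
  classical
  have h1 : ∀ σ ∈ U τ, ∑ t ∈ D σ, F t = F τ + ∑ t ∈ (D σ).erase τ, F t := by
    intro σ hσ
    rw [Finset.add_sum_erase _ _ (mem_D.2 (mem_U.1 hσ))]
  have h2 : ∀ κ ∈ D τ, ∑ t ∈ U κ, F t = F τ + ∑ t ∈ (U κ).erase τ, F t := by
    intro κ hκ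
    rw [Finset.add_sum_erase _ _ (mem_U.2 (mem_D.1 hκ))]
  rw [Finset.sum_congr rfl h1, Finset.sum_congr rfl h2, Finset.sum_add_distrib,
    Finset.sum_add_distrib, Finset.sum_const, Finset.sum_const, card_U, add_smul, one_smul]
  have h3 : ∑ σ ∈ U τ, ∑ t ∈ (D σ).erase τ, F t = ∑ κ ∈ D τ, ∑ t ∈ (U κ).erase τ, F t := by
    rw [Finset.sum_sigma', Finset.sum_sigma']
    refine Finset.sum_bij' (fun p _ => ⟨τ ⊓ p.2, p.2⟩) (fun p _ => ⟨τ ⊔ p.2, p.2⟩) ?_ ?_ ?_ ?_ ?_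
    · rintro ⟨σ, t⟩ h
      simp only [Finset.mem_sigma, Finset.mem_erase, mem_U, mem_D] at h ⊢
      obtain ⟨h1, h2, h3⟩ := h
      refine ⟨(covers_inf h1 h3 (Ne.symm h2)).1, h2, ?_⟩
      rw [inf_comm]
      exact (covers_inf h3 h1 h2).1
    · rintro ⟨σ, t⟩ h
      simp only [Finset.mem_sigma, Finset.mem_erase, mem_U, mem_D] at h ⊢
      obtain ⟨h1, h2, h3⟩ := h
      refine ⟨(covers_sup h1 h3 (Ne.symm h2)).1, h2, ?_⟩
      rw [sup_comm]
      exact (covers_sup h3 h1 h2).1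
    · rintro ⟨σ, t⟩ h
      simp only [Finset.mem_sigma, Finset.mem_erase, mem_U, mem_D] at h ⊢
      obtain ⟨h1, h2, h3⟩ := h
      rw [(covers_inf h1 h3 (Ne.symm h2)).2]
    · rintro ⟨σ, t⟩ h
      simp only [Finset.mem_sigma, Finset.mem_erase, mem_U, mem_D] at h ⊢
      obtain ⟨h1, h2, h3⟩ := h
      rw [(covers_sup h1 h3 (Ne.symm h2)).2]
    · rintro ⟨σ, t⟩ h
      rfl
  rw [h3]
  ring

theorem sum_up (k : ℕ) : ∀ τ : YoungDiagram, τ.card = k →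
    ∑ σ ∈ U τ, dimSYT σ = (k + 1) * dimSYT τ := by
  induction k with
  | zero =>
    intro τ hτ
    have hD : D τ = ∅ := by
      apply Finset.eq_empty_of_forall_notMem
      intro κ hκ
      have := covers_pos (mem_D.1 hκ)
      omega
    rw [Finset.sum_congr rfl fun σ hσ => dimSYT_rec σ (covers_pos (mem_U.1 hσ)), sum_UD, hD]
    simp
  | succ k ih =>
    intro τ hτ
    rw [Finset.sum_congr rfl fun σ hσ => dimSYT_rec σ (covers_pos (mem_U.1 hσ)), sum_UD,
      Finset.sum_congr rfl fun κ hκ => ih κ (by have := (mem_D.1 hκ).2; omega),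
      ← Finset.mul_sum, ← dimSYT_rec τ (by omega)]
    ring

end YoungAux

/-- The wreath dimension as a single product. -/
theorem wreathDim_eq {ι : Type} [Fintype ι] (d : ι → ℕ) (n : ℕ) (lam : ι → YoungDiagram) :
    wreathDim d n lam = (n.factorial : ℝ) *
      ∏ i, ((d i : ℝ) ^ ((lam i).card) * (dimSYT (lam i) : ℝ) / ((lam i).card.factorial : ℝ)) := by
  unfold wreathDim
  rw [Finset.prod_div_distrib]
  ring

theorem wreath_inner {ι : Type} [Fintype ι] [DecidableEq ι] (d : ι → ℕ) (m : ℕ)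
    (ν : ι → YoungDiagram) (i : ι) :
    ∑ σ ∈ YoungAux.U (ν i), (d i : ℝ) * wreathDim d (m + 1) (Function.update ν i σ)
      = (d i : ℝ) ^ 2 * ((m + 1 : ℕ) : ℝ) * wreathDim d m ν := by
  have hup := YoungAux.sum_up (ν i).card (ν i) rfl
  have hup' : ∑ σ ∈ YoungAux.U (ν i), (dimSYT σ : ℝ)
      = (((ν i).card : ℝ) + 1) * (dimSYT (ν i) : ℝ) := by exact_mod_cast hup
  set P : ℝ := ∏ j ∈ Finset.univ.erase i,
    ((d j : ℝ) ^ ((ν j).card) * (dimSYT (ν j) : ℝ) / ((ν j).card.factorial : ℝ)) with hP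
  have h1 : ∀ σ ∈ YoungAux.U (ν i), (d i : ℝ) * wreathDim d (m + 1) (Function.update ν i σ)
      = ((d i : ℝ) * ((m + 1).factorial : ℝ) * ((d i : ℝ) ^ ((ν i).card + 1) /
          (((ν i).card + 1).factorial : ℝ)) * P) * (dimSYT σ : ℝ) := by
    intro σ hσ
    have hc : σ.card = (ν i).card + 1 := (YoungAux.mem_U.1 hσ).2
    rw [wreathDim_eq, ← Finset.mul_prod_erase Finset.univ _ (Finset.mem_univ i)]
    have : ∏ j ∈ Finset.univ.erase i, ((d j : ℝ) ^ ((Function.update ν i σ j).card) *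
        (dimSYT (Function.update ν i σ j) : ℝ) / ((Function.update ν i σ j).card.factorial : ℝ))
        = P := by
      refine Finset.prod_congr rfl fun j hj => ?_
      rw [Function.update_of_ne (Finset.ne_of_mem_erase hj)]
    rw [this, Function.update_self, hc]
    ring
  rw [Finset.sum_congr rfl h1, ← Finset.mul_sum, hup', wreathDim_eq,
    ← Finset.mul_prod_erase Finset.univ _ (Finset.mem_univ i), ← hP,
    Nat.factorial_succ, Nat.factorial_succ]
  have : ((ν i).card.factorial : ℝ) ≠ 0 := by positivity
  have : (((ν i).card : ℝ) + 1) ≠ 0 := by positivity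
  push_cast
  field_simp
  ring

/-- Adding one box to a multi-partition: choose the entry and the enlarged diagram. -/
noncomputable def multiUpEquiv {ι : Type} [DecidableEq ι] (ν : ι → YoungDiagram) :
    (Σ i, {σ // σ ∈ YoungAux.U (ν i)}) ≃ {p : ι × (ι → YoungDiagram) //
            YDCovers (ν p.1) (p.2 p.1) ∧ ∀ j ≠ p.1, p.2 j = ν j} where
  toFun x := ⟨(x.1, Function.update ν x.1 x.2.1), by
    simpa using YoungAux.mem_U.1 x.2.2, fun j hj => Function.update_of_ne hj _ _⟩
  invFun p := ⟨p.1.1, p.1.2 p.1.1, YoungAux.mem_U.2 p.2.1⟩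
  left_inv := by
    rintro ⟨i, σ, h⟩
    simp
  right_inv := by
    rintro ⟨⟨i, μ⟩, h1, h2⟩
    apply Subtype.ext
    refine Prod.ext rfl ?_
    funext j
    by_cases hj : j = i
    · subst hj; simp
    · exact (Function.update_of_ne hj _ _).trans (h2 j hj).symm

/-- the reciprocal branching identity for the wreath-product dimension
formula: n·|T|·dim ν = Σ_{μ : ν ↗ μ} (dim ζ_{νμ}) · dim μ, the sum running over
multi-partitions μ of total size n obtained from ν (of total size n−1) by adding one box,
ζ_{νμ} being the entry where the box is added (encoded below as the pair p = (ζ, μ)). -/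
theorem wreath_reciprocal_branching_identity
    (T : Type) [Group T] [Finite T]
    (ι : Type) [Fintype ι] (ρ : ι → FDRep ℂ T)
    (hs : ∀ i, Simple (ρ i)) (hd : ∀ i j, Nonempty (ρ i ≅ ρ j) → i = j)
    (hc : ∀ V : FDRep ℂ T, Simple V → ∃ i, Nonempty (V ≅ ρ i))
    (n : ℕ) (hn : 1 ≤ n)
    (ν : ι → YoungDiagram) (hν : ∑ i, (ν i).card = n - 1) :
    (n : ℝ) * (Nat.card T : ℝ) * wreathDim (fun i => Module.finrank ℂ (ρ i)) (n - 1) ν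
      = ∑' p : {p : ι × (ι → YoungDiagram) //
            YDCovers (ν p.1) (p.2 p.1) ∧ ∀ j ≠ p.1, p.2 j = ν j},
          (Module.finrank ℂ (ρ p.1.1) : ℝ) *
            wreathDim (fun i => Module.finrank ℂ (ρ i)) n p.1.2 := by
  classical
  obtain ⟨m, rfl⟩ : ∃ m, n = m + 1 := ⟨n - 1, by omega⟩
  rw [← (multiUpEquiv ν).tsum_eq, tsum_fintype, Fintype.sum_sigma]
  have h : ∀ i, (∑ y : {σ // σ ∈ YoungAux.U (ν i)},
      (Module.finrank ℂ (ρ ((multiUpEquiv ν) ⟨i, y⟩).1.1) : ℝ) *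
        wreathDim (fun i => Module.finrank ℂ (ρ i)) (m + 1) ((multiUpEquiv ν) ⟨i, y⟩).1.2)
      = (Module.finrank ℂ (ρ i) : ℝ) ^ 2 * ((m + 1 : ℕ) : ℝ) *
        wreathDim (fun i => Module.finrank ℂ (ρ i)) m ν := by
    intro i
    rw [← wreath_inner (fun i => Module.finrank ℂ (ρ i)) m ν i]
    exact Finset.sum_coe_sort (YoungAux.U (ν i)) (fun σ => (Module.finrank ℂ (ρ i) : ℝ) *
      wreathDim (fun i => Module.finrank ℂ (ρ i)) (m + 1) (Function.update ν i σ))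
  rw [Finset.sum_congr rfl fun i _ => h i, ← Finset.sum_mul, ← Finset.sum_mul]
  have hsq : ∑ i, (Module.finrank ℂ (ρ i) : ℝ) ^ 2 = (Nat.card T : ℝ) := by
    exact_mod_cast sum_sq_dims T ι ρ hs hd hc
  rw [hsq, Nat.add_sub_cancel]
  ring
end
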